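/- There is no equivelar combinatorial surface with Euler characteristic −1; that is, for no n does there exist an equivelar combinatorial surface on Fin n with χ = −1. (Equivalently: the non-orientable surface of genus 3 admits no equivelar triangulation.) -/

import Mathlib

open Finset

section Defs

variable {α : Type*} [DecidableEq α]

/-- The 1-skeleton graph of a set of faces: two vertices are adjacent
if they lie together in a common face of `S`. -/
def skeletonGraph (S : Finset (Finset α)) : SimpleGraph α where
  Adj a b := a ≠ b ∧ ∃ T ∈ S, a ∈ T ∧ b ∈ T
  symm := by
    constructor
    rintro a b ⟨hab, T, hT, ha, hb⟩
    exact ⟨hab.symm, T, hT, hb, ha⟩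
  loopless := by constructor; rintro a ⟨h, -⟩; exact h rfl

/-- The link graph of a vertex `v`: `a` and `b` are adjacent
if `{v, a, b}` is a triangle of `S`. -/
def linkGraph (S : Finset (Finset α)) (v : α) : SimpleGraph α where
  Adj a b := a ≠ b ∧ ({v, a, b} : Finset α) ∈ S
  symm := by
    constructor
    rintro a b ⟨hab, h⟩
    refine ⟨hab.symm, ?_⟩
    rwa [Finset.pair_comm b a]
  loopless := by constructor; rintro a ⟨h, -⟩; exact h rfl

/-- The set of neighbors of the vertex `v` in `S`. -/
def nbrSet (S : Finset (Finset α)) (v : α) : Set α :=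
  {a | a ≠ v ∧ ∃ T ∈ S, v ∈ T ∧ a ∈ T}

/-- The edges of `S`: the 2-element subsets of `V` contained in some face of `S`. -/
def edgesOn (V : Finset α) (S : Finset (Finset α)) : Finset (Finset α) :=
  V.powerset.filter fun e => e.card = 2 ∧ ∃ T ∈ S, e ⊆ T

/-- `S` is a combinatorial surface on the vertex set `V`: all faces are triangles
on `V`, every vertex of `V` lies in a triangle, every edge lies in exactly two
triangles, the link graph of every vertex (induced on the neighbors of the
vertex) is connected, and the 1-skeleton (induced on `V`) is connected. -/
def IsCombSurfaceOn (V : Finset α) (S : Finset (Finset α)) : Prop :=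
  (∀ T ∈ S, T.card = 3 ∧ T ⊆ V) ∧
  (∀ v ∈ V, ∃ T ∈ S, v ∈ T) ∧
  (∀ e : Finset α, e.card = 2 → (∃ T ∈ S, e ⊆ T) →
    (S.filter fun T => e ⊆ T).card = 2) ∧
  (∀ v ∈ V, ((linkGraph S v).induce (nbrSet S v)).Connected) ∧
  ((skeletonGraph S).induce (V : Set α)).Connected

/-- The Euler characteristic `χ = |V| - f₁ + f₂` of `S` on the vertex set `V`. -/
def eulerCharOn (V : Finset α) (S : Finset (Finset α)) : ℤ :=
  (V.card : ℤ) - ((edgesOn V S).card : ℤ) + (S.card : ℤ)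

/-- `S` is equivelar (degree-regular): all vertices of `V` lie in the same
number `q` of triangles. -/
def IsEquivelarOn (V : Finset α) (S : Finset (Finset α)) : Prop :=
  ∃ q : ℕ, ∀ v ∈ V, (S.filter fun T => v ∈ T).card = q

/-- The directed edges of the cyclic ordering given by an ordered triple. -/
def dirEdges (t : α × α × α) : Finset (α × α) :=
  {(t.1, t.2.1), (t.2.1, t.2.2), (t.2.2, t.1)}

/-- `S` is orientable: one can choose a cyclic ordering of each triangle so that
for every edge `{a, b}` lying in two triangles, the two chosen cyclic orderings
traverse the edge in opposite directions. -/
def IsOrientable (S : Finset (Finset α)) : Prop :=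
  ∃ o : Finset α → α × α × α,
    (∀ T ∈ S, ({(o T).1, (o T).2.1, (o T).2.2} : Finset α) = T) ∧
    (∀ T ∈ S, ∀ T' ∈ S, T ≠ T' → ∀ x y : α,
      (x, y) ∈ dirEdges (o T) → ({x, y} : Finset α) ⊆ T' →
      (y, x) ∈ dirEdges (o T'))

/-- The link of a vertex `v` in a 3-dimensional complex `S`:
the triangles `{a,b,c}` with `{v,a,b,c} ∈ S`. -/
def linkOf (S : Finset (Finset α)) (v : α) : Finset (Finset α) :=
  (S.filter fun T => v ∈ T).image fun T => T.erase v

end Defs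

/-- `S` is a combinatorial surface on the vertex set `Fin n`. -/
def IsCombSurface (n : ℕ) (S : Finset (Finset (Fin n))) : Prop :=
  IsCombSurfaceOn Finset.univ S

/-- The Euler characteristic of a complex on the vertex set `Fin n`. -/
def eulerChar (n : ℕ) (S : Finset (Finset (Fin n))) : ℤ :=
  eulerCharOn Finset.univ S

/-- `S` is equivelar on `Fin n`. -/
def IsEquivelar (n : ℕ) (S : Finset (Finset (Fin n))) : Prop :=
  IsEquivelarOn Finset.univ S

/-- `S` is neighborly: every 2-element subset of `Fin n` is an edge. -/
def IsNeighborly (n : ℕ) (S : Finset (Finset (Fin n))) : Prop :=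
  ∀ e : Finset (Fin n), e.card = 2 → ∃ T ∈ S, e ⊆ T

/-- Two labeled complexes on `Fin n` are isomorphic if a permutation of the
vertices maps the faces of one onto the faces of the other. -/
def IsoComplex (n : ℕ) (S S' : Finset (Finset (Fin n))) : Prop :=
  ∃ σ : Equiv.Perm (Fin n), S.image (fun T => T.image σ) = S'

/-- The number of isomorphism classes (orbits under the symmetric group)
of complexes on `Fin n` satisfying `P`. -/
noncomputable def numClasses (n : ℕ) (P : Finset (Finset (Fin n)) → Prop) : ℕ :=
  Nat.card (Quot fun A B : {S : Finset (Finset (Fin n)) // P S} => IsoComplex n A.1 B.1)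

/-- The neighbors of a vertex `v` in a complex `S` on `Fin n`. -/
def vertexNbrs (n : ℕ) (S : Finset (Finset (Fin n))) (v : Fin n) : Finset (Fin n) :=
  Finset.univ.filter fun a => a ≠ v ∧ ∃ T ∈ S, v ∈ T ∧ a ∈ T

/-- `S` is a combinatorial 3-manifold on the vertex set `Fin n`: all faces are
tetrahedra, every vertex lies in a tetrahedron, every triangle contained in a
tetrahedron lies in exactly two tetrahedra, the link of every vertex is a
combinatorial surface (on the neighbors of the vertex) with Euler
characteristic 2, and the 1-skeleton is connected. -/
def IsComb3Manifold (n : ℕ) (S : Finset (Finset (Fin n))) : Prop :=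
  (∀ T ∈ S, T.card = 4) ∧
  (∀ v : Fin n, ∃ T ∈ S, v ∈ T) ∧
  (∀ F : Finset (Fin n), F.card = 3 → (∃ T ∈ S, F ⊆ T) →
    (S.filter fun T => F ⊆ T).card = 2) ∧
  (∀ v : Fin n, IsCombSurfaceOn (vertexNbrs n S v) (linkOf S v) ∧
    eulerCharOn (vertexNbrs n S v) (linkOf S v) = 2) ∧
  (skeletonGraph S).Connected

/-- There is no equivelar combinatorial surface with Euler characteristic -1:
the non-orientable surface of genus 3 admits no equivelar triangulation. -/
theorem no_equivelar_chi_neg_one :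
    ¬ ∃ (n : ℕ) (S : Finset (Finset (Fin n))),
      IsCombSurface n S ∧ IsEquivelar n S ∧ eulerChar n S = -1 := by
  rintro ⟨n, S, ⟨hT, -, hE, -, -⟩, ⟨q, hq⟩, hχ⟩
  have h1 : (Finset.univ : Finset (Fin n)).card * q = S.card * 3 := by
    apply Finset.card_mul_eq_card_mul (fun (v : Fin n) (T : Finset (Fin n)) => v ∈ T)
    · intro v hv
      exact hq v hv
    · intro T hTS
      rw [← (hT T hTS).1]
      congr 1
      ext v
      simp [Finset.bipartiteBelow]
  have h2 : (edgesOn Finset.univ S).card * 2 = S.card * 3 := by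
    apply Finset.card_mul_eq_card_mul (fun (e T : Finset (Fin n)) => e ⊆ T)
    · intro e he
      simp only [edgesOn, Finset.mem_filter] at he
      exact hE e he.2.1 he.2.2
    · intro T hTS
      have : (Finset.powersetCard 2 T).card = 3 := by
        rw [Finset.card_powersetCard, (hT T hTS).1]; rfl
      rw [← this]
      congr 1
      ext e
      simp only [Finset.bipartiteBelow, edgesOn, Finset.mem_filter, Finset.mem_powersetCard,
        Finset.mem_powerset]
      constructor
      · rintro ⟨⟨_, h, _⟩, h'⟩
        exact ⟨h', h⟩
      · rintro ⟨h', h⟩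
        exact ⟨⟨Finset.subset_univ _, h, T, hTS, h'⟩, h'⟩
  have h3 : (edgesOn Finset.univ S).card ≤ n.choose 2 := by
    have : edgesOn Finset.univ S ⊆ Finset.powersetCard 2 (Finset.univ : Finset (Fin n)) := by
      intro e he
      simp only [edgesOn, Finset.mem_filter] at he
      exact Finset.mem_powersetCard.2 ⟨Finset.subset_univ _, he.2.1⟩
    simpa using Finset.card_le_card this
  simp only [eulerChar, eulerCharOn, Finset.card_univ, Fintype.card_fin] at hχ h1
  generalize (edgesOn Finset.univ S).card = f1 at *
  have hd : n * q = n * 6 + 6 := by omega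
  have hn : n ∣ 6 := (Nat.dvd_add_right (Dvd.intro 6 rfl)).1 (hd ▸ Dvd.intro q rfl)
  have hle : n ≤ 6 := Nat.le_of_dvd (by norm_num) hn
  interval_cases n <;> simp [Nat.choose] at h3 <;> omega
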